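/- arXiv:2006.10257 — 5 statements merged into one kernel-verified Lean document; each statement's English description precedes it below -/
import Mathlib

section
/- For every knot projection P (given by its Gauss code), the reductivity t(P) is less than or equal to Shimizu's reductivity r(P). -/
open List

/-- A (cyclic) word over the alphabet of crossings, representing a Gauss code. -/
abbrev Word := List ℕ

/-- A diagram: a finite multiset of cyclic words (its components). -/
abbrev Diagram := Multiset Word

/-- `w` is cyclically of the form `v`, i.e. some rotation of `w` equals `v`. -/
def CyclicForm (w v : Word) : Prop := ∃ n, w.rotate n = v

/-- A Gauss code of a knot projection: a nonempty cyclic double occurrence word,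
in which every crossing occurs exactly twice. -/
def IsKnotProj (w : Word) : Prop := w ≠ [] ∧ ∀ a ∈ w, w.count a = 2

/-- The crossing `a` is nugatory in `w`: `w` is cyclically of the form `a·u·a·v`
where no crossing occurs once in `u` and once in `v`. -/
def Nugatory (a : ℕ) (w : Word) : Prop :=
  ∃ u v, CyclicForm w ([a] ++ u ++ [a] ++ v) ∧
    ∀ x : ℕ, ¬ (u.count x = 1 ∧ v.count x = 1)

/-- A word is reducible when it has a nugatory crossing. -/
def Reducible (w : Word) : Prop := ∃ a, Nugatory a w

/-- A single splice at the crossing `a` on a diagram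
(`s = true`: Seifert splice, `s = false`: non-Seifert splice).
At a self-crossing `a` of a component `a·u·a·v`, the Seifert splice replaces it by
the two words `u`, `v`, the non-Seifert splice by the single word `u·reverse v`.
At a crossing shared by two components `a·p`, `a·q`, the Seifert splice merges them
into `p·q` (orientation-respecting concatenation), the non-Seifert splice into
`p·reverse q` (concatenation with one factor reversed). -/
def Splice (s : Bool) (a : ℕ) (D D' : Diagram) : Prop :=
  (∃ w u v, w ∈ D ∧ CyclicForm w ([a] ++ u ++ [a] ++ v) ∧
      D' = if s then u ::ₘ v ::ₘ D.erase w
           else (u ++ v.reverse) ::ₘ D.erase w) ∨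
  (∃ w₁ w₂ p q, w₁ ∈ D ∧ w₂ ∈ D.erase w₁ ∧
      CyclicForm w₁ ([a] ++ p) ∧ CyclicForm w₂ ([a] ++ q) ∧
      D' = (if s then p ++ q else p ++ q.reverse) ::ₘ (D.erase w₁).erase w₂)

/-- Sequential application of the listed splices (type, crossing) to a diagram. -/
def SpliceSeq : List (Bool × ℕ) → Diagram → Diagram → Prop
  | [], D, D' => D' = D
  | (s, a) :: L, D, D' => ∃ D'', Splice s a D D'' ∧ SpliceSeq L D'' D'

/-- `n` splices of the allowed kinds, applied simultaneously (i.e. at pairwise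
distinct crossings) to the knot projection `w`, yield the single-component word `w'`. -/
def SimulSplice (allowed : Bool → Prop) (n : ℕ) (w w' : Word) : Prop :=
  ∃ L : List (Bool × ℕ), L.length = n ∧ (L.map Prod.snd).Nodup ∧
    (∀ p ∈ L, allowed p.1) ∧ SpliceSeq L {w} {w'}

/-- `t(P)`: the minimum number of splices (of either type), applied simultaneously,
needed to obtain a single-component reducible word from `w`. -/
noncomputable def tRed (w : Word) : ℕ :=
  sInf {n | ∃ w', SimulSplice (fun _ => True) n w w' ∧ Reducible w'}

/-- `y(P)`: the minimum number of non-Seifert splices, applied simultaneously,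
needed to obtain a single-component reducible word from `w`. -/
noncomputable def yRed (w : Word) : ℕ :=
  sInf {n | ∃ w', SimulSplice (fun s => s = false) n w w' ∧ Reducible w'}

/-- `i(P)`: the minimum number of Seifert splices, applied simultaneously,
needed to obtain a single-component reducible word from `w`. -/
noncomputable def iRed (w : Word) : ℕ :=
  sInf {n | ∃ w', SimulSplice (fun s => s = true) n w w' ∧ Reducible w'}

/-- One non-Seifert splice at a self-crossing of a knot projection:
`a·u·a·v` becomes `u·reverse v`. -/
def NonSeifert1 (w w' : Word) : Prop :=
  ∃ a u v, CyclicForm w ([a] ++ u ++ [a] ++ v) ∧ w' = u ++ v.reverse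

/-- `n` non-Seifert splices applied recursively (one at a time). -/
def NonSeifertIter : ℕ → Word → Word → Prop
  | 0, w, w' => w' = w
  | n + 1, w, w' => ∃ w'', NonSeifert1 w w'' ∧ NonSeifertIter n w'' w'

/-- Shimizu's reductivity `r(P)`: the minimum number of non-Seifert splices,
applied recursively, needed to obtain a reducible knot projection from `w`. -/
noncomputable def rRed (w : Word) : ℕ :=
  sInf {n | ∃ w', NonSeifertIter n w w' ∧ Reducible w'}

theorem CyclicForm.perm_splice {w u v : Word} {a : ℕ}
    (h : CyclicForm w ([a] ++ u ++ [a] ++ v)) : w ~ a :: a :: (u ++ v.reverse) := by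
  obtain ⟨n, hn⟩ := h
  rw [← (w.rotate_perm n).congr_left, hn, List.perm_iff_count]
  intro x
  simp only [List.count_append, List.count_cons, List.count_nil, List.count_reverse]
  omega

/-- A sequence of non-Seifert splices at self-crossings involves pairwise distinct crossings. -/
theorem NonSeifertIter.exists_spliceSeq {n : ℕ} {w w' : Word} (h : NonSeifertIter n w w')
    (hw : ∀ a, w.count a ≤ 2) :
    ∃ L : List (Bool × ℕ), L.length = n ∧ (L.map Prod.snd).Nodup ∧
      (∀ p ∈ L, p.2 ∈ w) ∧ SpliceSeq L {w} {w'} := by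
  induction n generalizing w with
  | zero =>
    obtain rfl : w' = w := h
    exact ⟨[], rfl, List.nodup_nil, by simp, rfl⟩
  | succ n ih =>
    obtain ⟨x, ⟨a, u, v, hc, rfl⟩, hx⟩ := h
    have hp := hc.perm_splice
    have hcount : ∀ b, (a :: a :: (u ++ v.reverse)).count b ≤ 2 := fun b =>
      hp.count_eq b ▸ hw b
    obtain ⟨L, hlen, hnodup, hmem, hseq⟩ := ih hx fun b => by
      have := hcount b
      simp only [List.count_cons] at this
      omega
    have ha : a ∉ u ++ v.reverse := by
      have := hcount a
      simp only [List.count_cons_self] at this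
      exact List.count_eq_zero.1 (by omega)
    refine ⟨(false, a) :: L, by simp [hlen], ?_, ?_, {u ++ v.reverse}, ?_, hseq⟩
    · rw [List.map_cons, List.nodup_cons]
      refine ⟨fun h => ?_, hnodup⟩
      obtain ⟨p, hpL, rfl⟩ := List.mem_map.1 h
      exact ha (hmem p hpL)
    · intro p hpL
      rw [hp.mem_iff]
      rcases List.mem_cons.1 hpL with rfl | hpL
      · simp
      · exact List.mem_cons_of_mem _ (List.mem_cons_of_mem _ (hmem p hpL))
    · exact Or.inl ⟨w, u, v, by simp, hc, by simp⟩

/-- Every knot projection becomes reducible after finitely many non-Seifert splices. -/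
theorem IsKnotProj.exists_nonSeifertIter {w : Word} (hw : IsKnotProj w) :
    ∃ n w', NonSeifertIter n w w' ∧ Reducible w' := by
  induction hl : w.length using Nat.strong_induction_on generalizing w with
  | _ l ih =>
    obtain ⟨hne, hcount⟩ := hw
    obtain ⟨a, t, rfl⟩ := List.exists_cons_of_ne_nil hne
    have hat : a ∈ t := by
      have := hcount a (by simp)
      rw [List.count_cons_self] at this
      exact List.count_pos_iff.1 (by omega)
    obtain ⟨u, v, rfl⟩ := List.append_of_mem hat
    have hc : CyclicForm (a :: (u ++ a :: v)) ([a] ++ u ++ [a] ++ v) := ⟨0, by simp⟩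
    by_cases hnil : u ++ v.reverse = []
    · obtain ⟨rfl, hv⟩ := List.append_eq_nil_iff.1 hnil
      exact ⟨0, _, rfl, a, [], v, hc, by simp⟩
    · have hp := hc.perm_splice
      have ha : a ∉ u ++ v.reverse := by
        have := hp.count_eq a ▸ hcount a (by simp)
        simp only [List.count_cons_self] at this
        exact List.count_eq_zero.1 (by omega)
      have hk : IsKnotProj (u ++ v.reverse) := by
        refine ⟨hnil, fun b hb => ?_⟩
        have hab : a ≠ b := fun h => ha (h ▸ hb)
        have := hp.count_eq b ▸ hcount b
          (hp.mem_iff.2 (List.mem_cons_of_mem _ (List.mem_cons_of_mem _ hb)))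
        rwa [List.count_cons_of_ne hab, List.count_cons_of_ne hab] at this
      obtain ⟨n, w', hn, hr⟩ := ih _ (by simp [← hl]) hk rfl
      exact ⟨n + 1, w', ⟨_, ⟨a, u, v, hc, rfl⟩, hn⟩, hr⟩

/-- For every knot projection `P`, `t(P) ≤ r(P)`. -/
theorem tRed_le_rRed (w : Word) (hw : IsKnotProj w) : tRed w ≤ rRed w := by
  obtain ⟨n, hn⟩ := hw.exists_nonSeifertIter
  obtain ⟨w', hiter, hred⟩ := Nat.sInf_mem (s := {n | ∃ w', NonSeifertIter n w w' ∧ Reducible w'})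
    ⟨n, hn⟩
  obtain ⟨L, hlen, hnodup, -, hseq⟩ := hiter.exists_spliceSeq fun a => by
    by_cases ha : a ∈ w
    · exact (hw.2 a ha).le
    · simp [List.count_eq_zero.2 ha]
  exact Nat.sInf_le ⟨w', ⟨L, hlen, hnodup, fun _ _ => trivial, hseq⟩, hred⟩
end

section
/- For every knot projection P (given by its Gauss code), the reductivity i(P) is an even nonnegative integer. -/
open List

/-- A Seifert splice changes the parity of the number of components. -/
theorem Splice.even_card_add {a : ℕ} {D D' : Diagram} (h : Splice true a D D') :
    Even (D'.card + D.card + 1) := by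
  rcases h with ⟨w, u, v, hw, -, rfl⟩ | ⟨w₁, w₂, p, q, h₁, h₂, -, -, rfl⟩
  · have := Multiset.card_erase_add_one hw
    simp only [if_true, Multiset.card_cons]
    grind
  · have := Multiset.card_erase_add_one h₁
    have := Multiset.card_erase_add_one h₂
    simp only [if_true, Multiset.card_cons]
    grind

/-- Applying a sequence of Seifert splices changes the number of components by an integer
of the same parity as the length of the sequence. -/
theorem SpliceSeq.even_card_add {L : List (Bool × ℕ)} {D D' : Diagram}
    (hL : ∀ p ∈ L, p.1 = true) (h : SpliceSeq L D D') :
    Even (D'.card + D.card + L.length) := by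
  induction L generalizing D with
  | nil =>
    obtain rfl : D' = D := h
    simp
  | cons p L ih =>
    obtain ⟨s, a⟩ := p
    obtain ⟨D'', hsplice, hseq⟩ := h
    obtain rfl : s = true := hL (s, a) (by simp)
    have h₁ := hsplice.even_card_add
    have h₂ := ih (fun p hp => hL p (by simp [hp])) hseq
    rw [List.length_cons]
    grind

/-- For every knot projection `P`, `i(P)` is an even nonnegative integer. -/
theorem iRed_even (w : Word) (hw : IsKnotProj w) : Even (iRed w) := by
  rcases Set.eq_empty_or_nonempty
      {n | ∃ w', SimulSplice (fun s => s = true) n w w' ∧ Reducible w'} with h | h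
  · simp [iRed, h]
  · obtain ⟨w', ⟨L, hlen, -, hL, hseq⟩, -⟩ := Nat.sInf_mem h
    have hpar := SpliceSeq.even_card_add hL hseq
    simp only [Multiset.card_singleton] at hpar
    rw [iRed, ← hlen]
    grind
end

section
/- For every integer m ≥ 1, the (2, 2m+1)-torus knot projection T, whose Gauss code is the cyclic word 1·2·⋯·(2m+1)·1·2·⋯·(2m+1), satisfies i(T) = 2m. -/
open List

/-- The Gauss code `1·2·⋯·(2m+1)·1·2·⋯·(2m+1)` of the `(2, 2m+1)`-torus knot projection. -/
def torusProj (m : ℕ) : Word :=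
  ((List.range (2 * m + 1)).map (· + 1)) ++ ((List.range (2 * m + 1)).map (· + 1))

theorem List.rotate_append_self {α : Type*} (X : List α) (n : ℕ) :
    (X ++ X).rotate n = X.rotate n ++ X.rotate n := by
  induction n generalizing X with
  | zero => simp
  | succ n ih =>
    cases X with
    | nil => simp
    | cons x X =>
      have h := ih (X ++ [x])
      simpa using h

theorem List.eq_of_append_self_eq {α : Type*} {a : α} {X u v : List α} (hX : X.Nodup)
    (h : X ++ X = [a] ++ u ++ [a] ++ v) : X = a :: u ∧ v = u := by
  cases X with
  | nil => simp at h
  | cons b Z =>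
    simp only [List.cons_append, List.nil_append, List.append_assoc, List.cons.injEq] at h
    obtain ⟨rfl, h⟩ := h
    have hb : b ∉ Z := (List.nodup_cons.mp hX).1
    rcases List.append_eq_append_iff.mp h with ⟨t, rfl, ht⟩ | ⟨t, rfl, ht⟩
    · cases t with
      | nil => simp_all
      | cons c t =>
        simp only [List.cons_append, List.cons.injEq] at ht
        exact absurd (by rw [ht.2]; simp) hb
    · cases t with
      | nil => simp_all
      | cons c t =>
        simp only [List.cons_append, List.cons.injEq] at ht
        exact absurd (by simp [ht.1]) hb

theorem List.eq_of_rotate_eq_cons {α : Type*} {a : α} {X p q : List α} {i j : ℕ}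
    (hX : X.Nodup) (hp : X.rotate i = a :: p) (hq : X.rotate j = a :: q) : p = q := by
  have h : (a :: p) ~r (a :: q) := by
    rw [← hp, ← hq]
    exact (List.IsRotated.forall X i).trans (List.IsRotated.forall X j).symm
  have hn : (a :: p).Nodup := hp ▸ List.nodup_rotate.mpr hX
  obtain ⟨k, hk, hkq⟩ := List.isRotated_iff_mod.mp h
  rcases Nat.eq_zero_or_pos k with rfl | hk0
  · simpa using hkq
  rcases hk.lt_or_eq with hlt | rfl
  · have h0 := List.getElem_rotate (a :: p) k 0 (by simp)
    simp only [hkq, List.getElem_cons_zero, Nat.zero_add, Nat.mod_eq_of_lt hlt] at h0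
    have := hn.getElem_inj_iff (i := 0) (j := k) (hi := by simp) (hj := hlt)
    simp only [List.getElem_cons_zero] at this
    have := this.mp h0
    omega
  · rw [List.rotate_length] at hkq
    simpa using hkq

/-- The diagrams reached from a `(2, n)`-torus projection by Seifert splices: the closed
two-strand braid with crossings `X`, which is connected (`true`) or has two components. -/
def twoStrand : Bool → Word → Diagram
  | true, X => {X ++ X}
  | false, X => {X, X}

theorem Splice.of_twoStrand {b : Bool} {a : ℕ} {X : Word} {D : Diagram} (hX : X.Nodup)
    (h : Splice true a (twoStrand b X) D) :
    ∃ Y : Word, D = twoStrand (!b) Y ∧ Y.Nodup ∧ Y.length + 1 = X.length := by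
  cases b with
  | true =>
    rcases h with ⟨w, u, v, hw, ⟨n, hn⟩, rfl⟩ | ⟨w₁, w₂, p, q, h₁, h₂, -, -, -⟩
    · obtain rfl : w = X ++ X := by simpa [twoStrand] using hw
      rw [List.rotate_append_self] at hn
      obtain ⟨hu, rfl⟩ := List.eq_of_append_self_eq (List.nodup_rotate.mpr hX) hn
      refine ⟨v, ?_, ?_, ?_⟩
      · simp [twoStrand]
      · exact (List.nodup_cons.mp (hu ▸ List.nodup_rotate.mpr hX)).2
      · simpa using (congrArg List.length hu).symm
    · obtain rfl : w₁ = X ++ X := by simpa [twoStrand] using h₁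
      simp [twoStrand] at h₂
  | false =>
    rcases h with ⟨w, u, v, hw, ⟨n, hn⟩, rfl⟩ | ⟨w₁, w₂, p, q, h₁, h₂, ⟨i, hi⟩, ⟨j, hj⟩, rfl⟩
    · obtain rfl : w = X := by simpa [twoStrand] using hw
      have : ([a] ++ u ++ [a] ++ v).Nodup := hn ▸ List.nodup_rotate.mpr hX
      simp at this
    · obtain rfl : w₁ = X := by simpa [twoStrand] using h₁
      obtain rfl : w₂ = w₁ := by simpa [twoStrand] using h₂
      obtain rfl := List.eq_of_rotate_eq_cons hX hi hj
      refine ⟨p, ?_, ?_, ?_⟩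
      · simp [twoStrand]
      · exact (List.nodup_cons.mp (hi ▸ List.nodup_rotate.mpr hX : ([a] ++ p).Nodup)).2
      · simpa using (congrArg List.length hi).symm

theorem SpliceSeq.of_twoStrand {L : List (Bool × ℕ)} {b : Bool} {X : Word} {D : Diagram}
    (hL : ∀ p ∈ L, p.1 = true) (hX : X.Nodup) (h : SpliceSeq L (twoStrand b X) D) :
    ∃ b' Y, D = twoStrand b' Y ∧ Y.Nodup ∧ Y.length + L.length = X.length := by
  induction L generalizing b X with
  | nil => exact ⟨b, X, h, hX, by simp⟩
  | cons s L ih =>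
    obtain ⟨s, a⟩ := s
    obtain rfl : s = true := hL (s, a) (by simp)
    obtain ⟨D', hs, hD⟩ := h
    obtain ⟨Y, rfl, hY, hlen⟩ := hs.of_twoStrand hX
    obtain ⟨b', Z, rfl, hZ, hlen'⟩ := ih (fun p hp => hL p (by simp [hp])) hY hD
    exact ⟨b', Z, rfl, hZ, by simp only [List.length_cons]; omega⟩

theorem splice_twoStrand_cons (b : Bool) (a : ℕ) (X : Word) :
    Splice true a (twoStrand b (a :: X)) (twoStrand (!b) X) := by
  cases b with
  | true =>
    exact Or.inl ⟨a :: X ++ a :: X, X, X, by simp [twoStrand], ⟨0, by simp⟩, by simp [twoStrand]⟩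
  | false =>
    exact Or.inr ⟨a :: X, a :: X, X, X, by simp [twoStrand], by simp [twoStrand], ⟨0, by simp⟩,
      ⟨0, by simp⟩, by simp [twoStrand]⟩

theorem spliceSeq_twoStrand_append (b : Bool) (L X : Word) :
    SpliceSeq (L.map (Prod.mk true)) (twoStrand b (L ++ X)) (twoStrand (not^[L.length] b) X) := by
  induction L generalizing b with
  | nil => rfl
  | cons a L ih => exact ⟨_, splice_twoStrand_cons b a (L ++ X), ih (!b)⟩

theorem reducible_append_self_iff {X : Word} (hX : X.Nodup) :
    Reducible (X ++ X) ↔ X.length = 1 := by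
  constructor
  · rintro ⟨a, u, v, ⟨n, hn⟩, h⟩
    rw [List.rotate_append_self] at hn
    have hX' : (X.rotate n).Nodup := List.nodup_rotate.mpr hX
    obtain ⟨hu, rfl⟩ := List.eq_of_append_self_eq hX' hn
    rw [hu] at hX'
    cases v with
    | nil => simpa using congrArg List.length hu
    | cons x v =>
      have := List.count_eq_one_of_mem hX'.of_cons (List.mem_cons_self (a := x) (l := v))
      exact absurd ⟨this, this⟩ (h x)
  · intro h
    obtain ⟨a, rfl⟩ := List.length_eq_one_iff.mp h
    exact ⟨a, [], [], ⟨0, by simp⟩, by simp⟩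

/-- For every `m ≥ 1`, the `(2, 2m+1)`-torus knot projection `T`
satisfies `i(T) = 2m`. -/
theorem iRed_torusProj (m : ℕ) (hm : 1 ≤ m) : iRed (torusProj m) = 2 * m := by
  have hnodup (n : ℕ) : ((List.range n).map (· + 1)).Nodup :=
    List.nodup_range.map (add_left_injective 1)
  suffices h : {n | ∃ w', SimulSplice (fun s => s = true) n (torusProj m) w' ∧ Reducible w'}
      = {2 * m} by
    rw [iRed, h, csInf_singleton]
  ext n
  simp only [Set.mem_ofPred_eq, Set.mem_singleton_iff]
  constructor
  · rintro ⟨w', ⟨L, rfl, -, hL, hseq⟩, hred⟩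
    obtain ⟨b, Y, hD, hY, hlen⟩ := SpliceSeq.of_twoStrand (b := true) hL (hnodup (2 * m + 1)) hseq
    cases b with
    | false => simpa [twoStrand] using congrArg Multiset.card hD
    | true =>
      obtain rfl : w' = Y ++ Y := by simpa [twoStrand] using hD
      have := (reducible_append_self_iff hY).mp hred
      simp only [List.length_map, List.length_range] at hlen
      omega
  · rintro rfl
    have hseq := spliceSeq_twoStrand_append true ((List.range (2 * m)).map (· + 1)) [2 * m + 1]
    rw [List.length_map, List.length_range, Bool.involutive_not.iterate_two_mul] at hseq
    refine ⟨[2 * m + 1] ++ [2 * m + 1], ⟨((List.range (2 * m)).map (· + 1)).map (Prod.mk true),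
      ?_, ?_, ?_, ?_⟩,
      (reducible_append_self_iff (by simp)).mpr rfl⟩
    · simp
    · rw [List.map_map]
      simpa using hnodup (2 * m)
    · simp
    · simpa [twoStrand, torusProj, List.range_succ] using hseq
end

section
/- For every knot projection P (given by its Gauss code), the following conditions are mutually equivalent: (1) t(P) = 1; (2) r(P) = 1; (3) y(P) = 1. -/
open List

theorem splice_singleton_iff (s : Bool) (a : ℕ) (w w' : Word) :
    Splice s a {w} {w'} ↔
      s = false ∧ ∃ u v, CyclicForm w ([a] ++ u ++ [a] ++ v) ∧ w' = u ++ v.reverse := by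
  constructor
  · rintro (⟨x, u, v, hx, hc, h⟩ | ⟨x, y, p, q, hx, hy, -⟩)
    · obtain rfl := Multiset.mem_singleton.1 hx
      cases s with
      | false => exact ⟨rfl, u, v, hc, by simpa using h⟩
      | true => simpa using congrArg Multiset.card h
    · obtain rfl := Multiset.mem_singleton.1 hx
      simp at hy
  · rintro ⟨rfl, u, v, hc, rfl⟩
    exact Or.inl ⟨w, u, v, by simp, hc, by simp⟩

theorem simulSplice_zero_iff (allowed : Bool → Prop) (w w' : Word) :
    SimulSplice allowed 0 w w' ↔ w' = w := by
  constructor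
  · rintro ⟨L, hL, -, -, h⟩
    obtain rfl := List.length_eq_zero_iff.1 hL
    exact Multiset.singleton_inj.1 h
  · rintro rfl
    exact ⟨[], by simp [SpliceSeq]⟩

theorem simulSplice_one_iff {allowed : Bool → Prop} (h_allowed : allowed false) (w w' : Word) :
    SimulSplice allowed 1 w w' ↔ NonSeifert1 w w' := by
  constructor
  · rintro ⟨L, hL, -, -, h⟩
    obtain ⟨⟨s, a⟩, rfl⟩ := List.length_eq_one_iff.1 hL
    obtain ⟨D, hD, rfl⟩ := h
    exact ⟨a, ((splice_singleton_iff s a w w').1 hD).2⟩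
  · rintro ⟨a, h⟩
    exact ⟨[(false, a)], rfl, by simp, by simpa using h_allowed,
      {w'}, (splice_singleton_iff false a w w').2 ⟨rfl, h⟩, rfl⟩

theorem Nat.sInf_eq_one_iff {S : Set ℕ} : sInf S = 1 ↔ 0 ∉ S ∧ 1 ∈ S := by
  constructor
  · intro h
    refine ⟨fun h0 => ?_, h ▸ Nat.sInf_mem (Nat.nonempty_of_pos_sInf (by omega))⟩
    have := Nat.sInf_le h0
    omega
  · rintro ⟨h0, h1⟩
    have hle := Nat.sInf_le h1
    have hne : sInf S ≠ 0 := fun h => h0 (h ▸ Nat.sInf_mem ⟨1, h1⟩)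
    omega

theorem rRed_eq_one_iff (w : Word) :
    rRed w = 1 ↔ ¬ Reducible w ∧ ∃ w', NonSeifert1 w w' ∧ Reducible w' := by
  simp [rRed, Nat.sInf_eq_one_iff, NonSeifertIter]

theorem sInf_simulSplice_eq_one_iff {allowed : Bool → Prop} (h_allowed : allowed false)
    (w : Word) :
    sInf {n | ∃ w', SimulSplice allowed n w w' ∧ Reducible w'} = 1 ↔
      ¬ Reducible w ∧ ∃ w', NonSeifert1 w w' ∧ Reducible w' := by
  simp [Nat.sInf_eq_one_iff, simulSplice_zero_iff, simulSplice_one_iff h_allowed]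

/-- For every knot projection `P`, the conditions `t(P) = 1`,
`r(P) = 1` and `y(P) = 1` are mutually equivalent. -/
theorem red_one_equiv (w : Word) (hw : IsKnotProj w) :
    (tRed w = 1 ↔ rRed w = 1) ∧ (rRed w = 1 ↔ yRed w = 1) := by
  rw [rRed_eq_one_iff, tRed, yRed, sInf_simulSplice_eq_one_iff trivial,
    sInf_simulSplice_eq_one_iff (allowed := fun s => s = false) rfl]
  exact ⟨Iff.rfl, Iff.rfl⟩
end

section
/- Let P be a reduced knot projection (given by its Gauss code). If r(P) = 2, then t(P) = 2. -/
open List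

theorem CyclicForm.perm {w v : Word} (h : CyclicForm w v) : w.Perm v := by
  obtain ⟨n, rfl⟩ := h
  exact (List.rotate_perm w n).symm

/-- A non-Seifert splice at `a` removes the crossing `a` from a double occurrence word. -/
theorem IsKnotProj.notMem_splice {w u v : Word} {a : ℕ} (hw : IsKnotProj w)
    (h : CyclicForm w ([a] ++ u ++ [a] ++ v)) : a ∉ u ++ v.reverse := by
  have ha : a ∈ w := h.perm.mem_iff.2 (by simp)
  have hc := h.perm.count_eq a
  rw [hw.2 a ha] at hc
  simp only [List.count_append, List.count_singleton_self] at hc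
  have hu : u.count a = 0 := by omega
  have hv : v.count a = 0 := by omega
  simpa using And.intro (List.count_eq_zero.1 hu) (List.count_eq_zero.1 hv)

theorem splice_false_singleton {w u v : Word} {a : ℕ}
    (h : CyclicForm w ([a] ++ u ++ [a] ++ v)) : Splice false a {w} {u ++ v.reverse} :=
  Or.inl ⟨w, u, v, by simp, h, by simp⟩

/-- Two recursive non-Seifert splices are splices at two distinct crossings. -/
theorem IsKnotProj.simulSplice_two {w w' : Word} (hw : IsKnotProj w)
    (h : NonSeifertIter 2 w w') : SimulSplice (fun _ => True) 2 w w' := by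
  obtain ⟨_, ⟨a, u, v, ha, rfl⟩, _, ⟨b, p, q, hb, rfl⟩, rfl⟩ := h
  have hab : a ≠ b := by
    rintro rfl
    exact hw.notMem_splice ha (hb.perm.mem_iff.2 (by simp))
  exact ⟨[(false, a), (false, b)], rfl, by simpa using hab, by simp,
    _, splice_false_singleton ha, _, splice_false_singleton hb, rfl⟩

theorem SimulSplice.eq_of_zero {allowed : Bool → Prop} {w w' : Word}
    (h : SimulSplice allowed 0 w w') : w' = w := by
  obtain ⟨L, hL, -, -, hs⟩ := h
  obtain rfl := List.length_eq_zero_iff.1 hL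
  exact Multiset.singleton_inj.1 hs

/-- A single splice of a knot projection with a one-component result is non-Seifert. -/
theorem SimulSplice.nonSeifertIter_one {allowed : Bool → Prop} {w w' : Word}
    (h : SimulSplice allowed 1 w w') : NonSeifertIter 1 w w' := by
  obtain ⟨L, hL, -, -, hs⟩ := h
  obtain ⟨⟨s, a⟩, rfl⟩ := List.length_eq_one_iff.1 hL
  obtain ⟨_, hs, rfl⟩ := hs
  rcases hs with ⟨x, u, v, hx, hc, hD⟩ | ⟨w₁, w₂, p, q, h₁, h₂, -⟩
  · obtain rfl := Multiset.mem_singleton.1 hx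
    cases s with
    | true => simpa using congrArg Multiset.card hD
    | false => exact ⟨w', ⟨a, u, v, hc, by simpa using hD⟩, rfl⟩
  · obtain rfl := Multiset.mem_singleton.1 h₁
    simp at h₂

/-- For a reduced knot projection `P`, if `r(P) = 2` then `t(P) = 2`. -/
theorem rRed_two_imp_tRed_two (w : Word) (hw : IsKnotProj w)
    (hred : ¬ Reducible w) (h : rRed w = 2) : tRed w = 2 := by
  have hmem : 2 ∈ {n | ∃ w', NonSeifertIter n w w' ∧ Reducible w'} :=
    h ▸ Nat.sInf_mem (Nat.nonempty_of_pos_sInf (Nat.zero_lt_two.trans_eq h.symm))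
  obtain ⟨w₂, hw₂, hr₂⟩ := hmem
  refine (show IsLeast {n | ∃ w', SimulSplice (fun _ => True) n w w' ∧ Reducible w'} 2 from
    ⟨⟨w₂, hw.simulSplice_two hw₂, hr₂⟩, ?_⟩).csInf_eq
  rintro n ⟨w', hs, hr⟩
  by_contra! hn
  interval_cases n
  · exact hred (hs.eq_of_zero ▸ hr)
  · have hle : rRed w ≤ 1 := Nat.sInf_le ⟨w', hs.nonSeifertIter_one, hr⟩
    omega
end
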